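/- Interface sparsification: there is an absolute constant c > 0 with the following property. Let G be a weighted undirected graph on n vertices with vertex partition V = V_A ⊔ V_B, and write its combinatorial Laplacian as L = L_int + L_cut, where L_int is the combinatorial Laplacian of the edges with both endpoints in the same part and L_cut is the combinatorial Laplacian of the crossing edges (those with one endpoint in V_A and one in V_B). Then for every ε ∈ (0,1) there exist nonnegative weights w'_e on the crossing edges, nonzero on at most ⌈c n log n / ε²⌉ of them, such that the graph G' obtained by keeping the intra-part edges of G and replacing the crossing-edge weights by w' has combinatorial Laplacian L' = L_int + L'_cut satisfying (1−ε) xᵀ L x ≤ xᵀ L' x ≤ (1+ε) xᵀ L x for all x ∈ ℝⁿ. -/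

import Mathlib

open Matrix Finset

/-- The combinatorial Laplacian of the weighted graph with weight function `w`. -/
def combLaplacian {n : ℕ} (w : Fin n → Fin n → ℝ) : Matrix (Fin n) (Fin n) ℝ :=
  Matrix.diagonal (fun i => ∑ j, w i j) - Matrix.of w

/-- positive definite, elementary form -/
def IfPD {κ : Type} [Fintype κ] (M : Matrix κ κ ℝ) : Prop :=
  Mᵀ = M ∧ ∀ x : κ → ℝ, x ≠ 0 → 0 < x ⬝ᵥ M *ᵥ x

lemma if_spec_sym {κ : Type} [Fintype κ] [DecidableEq κ] (M : Matrix κ κ ℝ) (h : Mᵀ = M) :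
    ∃ (μ : κ → ℝ) (U : Matrix κ κ ℝ), U * Uᵀ = 1 ∧ Uᵀ * U = 1 ∧ M = U * diagonal μ * Uᵀ := by
  have hH : M.IsHermitian := by
    rw [Matrix.IsHermitian, Matrix.conjTranspose_eq_transpose_of_trivial, h]
  refine ⟨hH.eigenvalues, (hH.eigenvectorUnitary : Matrix κ κ ℝ), ?_, ?_, ?_⟩
  · have := Unitary.mul_star_self_of_mem hH.eigenvectorUnitary.2
    rwa [Matrix.star_eq_conjTranspose, Matrix.conjTranspose_eq_transpose_of_trivial] at this
  · have := Unitary.star_mul_self_of_mem hH.eigenvectorUnitary.2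
    rwa [Matrix.star_eq_conjTranspose, Matrix.conjTranspose_eq_transpose_of_trivial] at this
  · have := hH.spectral_theorem
    rw [Unitary.conjStarAlgAut_apply] at this
    rw [Matrix.star_eq_conjTranspose, Matrix.conjTranspose_eq_transpose_of_trivial] at this
    exact this

lemma if_quad_diag {κ : Type} [Fintype κ] [DecidableEq κ] (μ : κ → ℝ) (U : Matrix κ κ ℝ)
    (x : κ → ℝ) : x ⬝ᵥ (U * diagonal μ * Uᵀ) *ᵥ x = ∑ j, μ j * ((Uᵀ *ᵥ x) j) ^ 2 := by
  rw [Matrix.mul_assoc, ← Matrix.mulVec_mulVec, Matrix.dotProduct_mulVec, ← Matrix.mulVec_transpose,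
    ← Matrix.mulVec_mulVec]
  simp only [dotProduct, Matrix.mulVec_diagonal]
  exact Finset.sum_congr rfl fun j _ => by ring

lemma if_PD_diag {κ : Type} [Fintype κ] [DecidableEq κ] (μ : κ → ℝ) (U : Matrix κ κ ℝ)
    (h1 : U * Uᵀ = 1) (hμ : ∀ j, 0 < μ j) : IfPD (U * diagonal μ * Uᵀ) := by
  refine ⟨by simp [Matrix.transpose_mul, Matrix.mul_assoc], fun x hx => ?_⟩
  rw [if_quad_diag]
  have hne : Uᵀ *ᵥ x ≠ 0 := by
    intro h0
    apply hx
    have : U *ᵥ (Uᵀ *ᵥ x) = x := by rw [Matrix.mulVec_mulVec, h1, Matrix.one_mulVec]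
    rw [← this, h0, Matrix.mulVec_zero]
  obtain ⟨j, hj⟩ := Function.ne_iff.mp hne
  exact Finset.sum_pos' (fun i _ => mul_nonneg (hμ i).le (sq_nonneg _))
    ⟨j, Finset.mem_univ _, mul_pos (hμ j) (by have : (Uᵀ *ᵥ x) j ≠ 0 := hj
                                              positivity)⟩

lemma if_spec {κ : Type} [Fintype κ] [DecidableEq κ] (M : Matrix κ κ ℝ) (h : IfPD M) :
    ∃ (μ : κ → ℝ) (U : Matrix κ κ ℝ), (∀ j, 0 < μ j) ∧ U * Uᵀ = 1 ∧ Uᵀ * U = 1 ∧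
      M = U * diagonal μ * Uᵀ := by
  obtain ⟨μ, U, h1, h2, h3⟩ := if_spec_sym M h.1
  refine ⟨μ, U, fun j => ?_, h1, h2, h3⟩
  have hc : Uᵀ *ᵥ (U *ᵥ (Pi.single j 1)) = Pi.single j 1 := by
    rw [Matrix.mulVec_mulVec, h2, Matrix.one_mulVec]
  have hne : U *ᵥ (Pi.single j 1) ≠ 0 := by
    intro h0
    rw [h0, Matrix.mulVec_zero] at hc
    have := congrFun hc j
    simp at this
  have := h.2 _ hne
  rw [h3, if_quad_diag, hc] at this
  simpa [Pi.single_apply] using this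

lemma if_shift {κ : Type} [Fintype κ] [DecidableEq κ] (μ : κ → ℝ) (U : Matrix κ κ ℝ)
    (h1 : U * Uᵀ = 1) (h2 : Uᵀ * U = 1) (c : ℝ) (hc : ∀ j, 0 < μ j + c)
    (M : Matrix κ κ ℝ) (hM : M = U * diagonal μ * Uᵀ) :
    IfPD (M + c • 1) ∧ trace (M + c • 1)⁻¹ = ∑ j, 1 / (μ j + c) ∧
      trace ((M + c • 1)⁻¹ * (M + c • 1)⁻¹) = ∑ j, (1 / (μ j + c)) ^ 2 := by
  have e : M + c • 1 = U * diagonal (fun j => μ j + c) * Uᵀ := by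
    have : (diagonal (fun j => μ j + c) : Matrix κ κ ℝ) = diagonal μ + c • 1 := by
      rw [← Matrix.diagonal_one, ← Matrix.diagonal_smul, Matrix.diagonal_add]
      simp
    rw [this, Matrix.mul_add, Matrix.add_mul, hM]
    simp [h1]
  have mulF : ∀ f g : κ → ℝ, (U * diagonal f * Uᵀ) * (U * diagonal g * Uᵀ)
      = U * diagonal (fun j => f j * g j) * Uᵀ := by
    intro f g
    calc _ = U * diagonal f * (Uᵀ * U) * diagonal g * Uᵀ := by simp only [Matrix.mul_assoc]
      _ = _ := by rw [h2, Matrix.mul_one, Matrix.mul_assoc U, Matrix.diagonal_mul_diagonal]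
  have trF : ∀ f : κ → ℝ, trace (U * diagonal f * Uᵀ) = ∑ j, f j := by
    intro f
    rw [Matrix.trace_mul_comm, ← Matrix.mul_assoc, h2, Matrix.one_mul, Matrix.trace_diagonal]
  have inv : (M + c • 1)⁻¹ = U * diagonal (fun j => 1 / (μ j + c)) * Uᵀ := by
    apply Matrix.inv_eq_right_inv
    rw [e, mulF]
    have : (fun j => (μ j + c) * (1 / (μ j + c))) = fun _ => 1 := by
      funext j
      have := (hc j).ne'
      field_simp
    rw [this, Matrix.diagonal_one, Matrix.mul_one, h1]
  refine ⟨?_, ?_, ?_⟩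
  · rw [e]; exact if_PD_diag _ _ h1 hc
  · rw [inv, trF]
  · rw [inv, mulF, trF]
    exact Finset.sum_congr rfl fun j _ => by ring

lemma if_PD_inv {κ : Type} [Fintype κ] [DecidableEq κ] (M : Matrix κ κ ℝ) (h : IfPD M) :
    M * M⁻¹ = 1 ∧ M⁻¹ᵀ = M⁻¹ := by
  obtain ⟨μ, U, hμ, h1, h2, h3⟩ := if_spec M h
  have : M * (U * diagonal (fun j => 1 / (μ j)) * Uᵀ) = 1 := by
    rw [h3]
    calc _ = U * diagonal μ * (Uᵀ * U) * diagonal (fun j => 1 / (μ j)) * Uᵀ := by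
          simp only [Matrix.mul_assoc]
      _ = 1 := by
        rw [h2, Matrix.mul_one, Matrix.mul_assoc U, Matrix.diagonal_mul_diagonal]
        have : (fun j => (μ j) * (1 / (μ j))) = fun _ => 1 := by
          funext j
          have := (hμ j).ne'
          field_simp
        rw [this, Matrix.diagonal_one, Matrix.mul_one, h1]
  refine ⟨?_, ?_⟩
  · rw [Matrix.inv_eq_right_inv this]; exact this
  · rw [Matrix.transpose_nonsing_inv, h.1]

lemma if_vv_mulVec {κ : Type} [Fintype κ] (v x : κ → ℝ) :
    vecMulVec v v *ᵥ x = (v ⬝ᵥ x) • v := by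
  ext i
  simp [vecMulVec, Matrix.mulVec, dotProduct, Finset.mul_sum, mul_comm, mul_left_comm]

lemma if_rank_one {κ : Type} [Fintype κ] [DecidableEq κ] (M : Matrix κ κ ℝ) (h : IfPD M)
    (v : κ → ℝ) (s : ℝ) (hs : 0 < 1 + s * (v ⬝ᵥ M⁻¹ *ᵥ v)) :
    IfPD (M + s • vecMulVec v v) ∧ trace (M + s • vecMulVec v v)⁻¹ =
      trace M⁻¹ - s / (1 + s * (v ⬝ᵥ M⁻¹ *ᵥ v)) * (v ⬝ᵥ (M⁻¹ * M⁻¹) *ᵥ v) := by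
  obtain ⟨hi, hsym⟩ := if_PD_inv M h
  set X := M⁻¹ with hX
  set c := v ⬝ᵥ X *ᵥ v with hc
  refine ⟨⟨?_, ?_⟩, ?_⟩
  · rw [Matrix.transpose_add, h.1, Matrix.transpose_smul, Matrix.transpose_vecMulVec]
  · intro x hx
    have hq := h.2 x hx
    rw [Matrix.add_mulVec, Matrix.smul_mulVec, if_vv_mulVec, dotProduct_add, dotProduct_smul,
      dotProduct_smul, dotProduct_comm x v, smul_eq_mul, smul_eq_mul]
    set p := v ⬝ᵥ x with hp
    by_cases hp0 : p = 0
    · rw [hp0]; simpa using hq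
    have hp2 : 0 < p ^ 2 := by positivity
    rcases le_or_gt 0 s with h0 | h0
    · have : 0 ≤ s * (p * p) := mul_nonneg h0 (mul_self_nonneg p)
      linarith
    · -- use x + s p X v
      have hMX : M *ᵥ (X *ᵥ v) = v := by rw [Matrix.mulVec_mulVec, hi, Matrix.one_mulVec]
      have hnn : ∀ y : κ → ℝ, 0 ≤ y ⬝ᵥ M *ᵥ y := by
        intro y
        by_cases hy : y = 0
        · simp [hy]
        · exact (h.2 y hy).le
      have := hnn (x + (s * p) • (X *ᵥ v))
      have e2 : (X *ᵥ v) ⬝ᵥ M *ᵥ x = p := by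
        rw [Matrix.dotProduct_mulVec, ← Matrix.mulVec_transpose, h.1, hMX]
      rw [Matrix.mulVec_add, Matrix.mulVec_smul, hMX, add_dotProduct, dotProduct_add, dotProduct_add,
        smul_dotProduct, smul_dotProduct, dotProduct_smul, dotProduct_smul, e2,
        dotProduct_comm x v, dotProduct_comm (X *ᵥ v) v, ← hc, ← hp] at this
      simp only [smul_eq_mul] at this
      nlinarith [mul_pos (mul_pos_of_neg_of_neg h0 (neg_lt_zero.mpr hs)) hp2]
  · have key : (M + s • vecMulVec v v)⁻¹
        = X - (s / (1 + s * c)) • vecMulVec (X *ᵥ v) (X *ᵥ v) := by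
      apply Matrix.inv_eq_right_inv
      rw [Matrix.add_mul, Matrix.mul_sub, Matrix.mul_sub, hi, Matrix.mul_smul, Matrix.mul_smul,
        Matrix.smul_mul, Matrix.smul_mul, Matrix.mul_vecMulVec, Matrix.mulVec_mulVec, hi,
        Matrix.one_mulVec, Matrix.vecMulVec_mul, Matrix.vecMulVec_mul_vecMulVec, ← hc,
        ← Matrix.mulVec_transpose, hsym, Matrix.vecMulVec_smul]
      have : s - s / (1 + s * c) - (s / (1 + s * c)) * (s * c) = 0 := by
        field_simp
        ring
      have h3 : (1 : Matrix κ κ ℝ) - (s / (1 + s * c)) • vecMulVec v (X *ᵥ v) +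
          (s • vecMulVec v (X *ᵥ v) - (s / (1 + s * c)) • s • c • vecMulVec v (X *ᵥ v))
          = 1 + (s - s / (1 + s * c) - (s / (1 + s * c)) * (s * c)) • vecMulVec v (X *ᵥ v) := by
        module
      rw [this] at h3
      simpa using h3
    rw [key, Matrix.trace_sub, Matrix.trace_smul, Matrix.trace_vecMulVec, smul_eq_mul]
    congr 2
    rw [← Matrix.mulVec_mulVec, Matrix.dotProduct_mulVec, ← Matrix.mulVec_transpose, hsym]
    simp [Matrix.dotProduct_mulVec,  ← Matrix.mulVec_transpose, hsym]

lemma if_scal_up {κ : Type} [Fintype κ] [Nonempty κ] (μ : κ → ℝ) (δ : ℝ)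
    (hμ : ∀ j, 0 < μ j) (hδ : 0 < δ) :
    0 < ∑ j, 1 / μ j - ∑ j, 1 / (μ j + δ) ∧
    (∑ j, (1 / (μ j + δ)) ^ 2) / (∑ j, 1 / μ j - ∑ j, 1 / (μ j + δ)) + ∑ j, 1 / (μ j + δ)
      ≤ 1 / δ + ∑ j, 1 / μ j := by
  have hD : 0 < ∑ j, 1 / μ j - ∑ j, 1 / (μ j + δ) := by
    rw [sub_pos]
    apply Finset.sum_lt_sum_of_nonempty Finset.univ_nonempty
    intro j _
    exact one_div_lt_one_div_of_lt (hμ j) (by linarith)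
  refine ⟨hD, ?_⟩
  have h1 : δ * ∑ j, (1 / (μ j + δ)) ^ 2 ≤ ∑ j, 1 / μ j - ∑ j, 1 / (μ j + δ) := by
    rw [← Finset.sum_sub_distrib, Finset.mul_sum]
    apply Finset.sum_le_sum
    intro j _
    have h := hμ j
    have e : 1 / μ j - 1 / (μ j + δ) - δ * (1 / (μ j + δ)) ^ 2 = δ ^ 2 / (μ j * (μ j + δ) ^ 2) := by
      field_simp
      ring
    have : 0 ≤ δ ^ 2 / (μ j * (μ j + δ) ^ 2) := by positivity
    linarith
  have h2 : (∑ j, (1 / (μ j + δ)) ^ 2) / (∑ j, 1 / μ j - ∑ j, 1 / (μ j + δ)) ≤ 1 / δ := by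
    rw [div_le_div_iff₀ hD hδ]
    linarith
  linarith

lemma if_scal_low {κ : Type} [Fintype κ] [Nonempty κ] (μ : κ → ℝ)
    (hμ : ∀ j, 1 < μ j) (hs : ∑ j, 1 / μ j ≤ 1) :
    0 < ∑ j, 1 / (μ j + -1) - ∑ j, 1 / μ j ∧
    1 - ∑ j, 1 / μ j ≤
    (∑ j, (1 / (μ j + -1)) ^ 2) / (∑ j, 1 / (μ j + -1) - ∑ j, 1 / μ j) - ∑ j, 1 / (μ j + -1) := by
  have hD : 0 < ∑ j, 1 / (μ j + -1) - ∑ j, 1 / μ j := by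
    rw [sub_pos]
    apply Finset.sum_lt_sum_of_nonempty Finset.univ_nonempty
    intro j _
    have := hμ j
    exact one_div_lt_one_div_of_lt (by linarith) (by linarith)
  refine ⟨hD, ?_⟩
  set D := ∑ j, 1 / (μ j + -1) - ∑ j, 1 / μ j with hDd
  have hDe : D = ∑ j, 1 / (μ j * (μ j + -1)) := by
    rw [hDd, ← Finset.sum_sub_distrib]
    refine Finset.sum_congr rfl fun j _ => ?_
    have := hμ j
    have h1 : μ j ≠ 0 := by linarith
    have h2 : μ j + -1 ≠ 0 := by linarith
    field_simp
    ring
  have hE : ∑ j, (1 / (μ j + -1)) ^ 2 - D = ∑ j, 1 / (μ j * (μ j + -1) ^ 2) := by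
    rw [hDe, ← Finset.sum_sub_distrib]
    refine Finset.sum_congr rfl fun j _ => ?_
    have := hμ j
    have h1 : μ j ≠ 0 := by linarith
    have h2 : μ j + -1 ≠ 0 := by linarith
    field_simp
    ring
  have hCS : D ^ 2 ≤ (∑ j, 1 / μ j) * ∑ j, 1 / (μ j * (μ j + -1) ^ 2) := by
    rw [hDe]
    apply Finset.sum_sq_le_sum_mul_sum_of_sq_le_mul
    · intro j _
      have := hμ j
      have : 0 < μ j := by linarith
      positivity
    · intro j _
      have := hμ j
      have : 0 < μ j := by linarith
      positivity
    · intro j _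
      have := hμ j
      have h1 : μ j ≠ 0 := by linarith
      have h2 : μ j + -1 ≠ 0 := by linarith
      apply le_of_eq
      field_simp
  have hnn : 0 ≤ ∑ j, 1 / (μ j * (μ j + -1) ^ 2) := by
    apply Finset.sum_nonneg
    intro j _
    have := hμ j
    have : 0 < μ j := by linarith
    positivity
  have h3 : 1 + D ≤ (∑ j, (1 / (μ j + -1)) ^ 2) / D := by
    rw [le_div_iff₀ hD]
    nlinarith
  linarith

lemma if_sum_trace {κ ι : Type} [Fintype κ] [DecidableEq κ] [Fintype ι] (v : ι → κ → ℝ)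
    (hv : ∑ i, vecMulVec (v i) (v i) = 1) (X : Matrix κ κ ℝ) :
    ∑ i, v i ⬝ᵥ X *ᵥ v i = trace X := by
  have : trace (X * ∑ i, vecMulVec (v i) (v i)) = trace X := by rw [hv, Matrix.mul_one]
  rw [← this, Matrix.mul_sum, Matrix.trace_sum]
  refine Finset.sum_congr rfl fun i _ => ?_
  rw [Matrix.mul_vecMulVec, Matrix.trace_vecMulVec, dotProduct_comm]

lemma if_inv_nonneg {κ : Type} [Fintype κ] [DecidableEq κ] (M : Matrix κ κ ℝ) (h : IfPD M)
    (v : κ → ℝ) : 0 ≤ v ⬝ᵥ M⁻¹ *ᵥ v ∧ 0 ≤ v ⬝ᵥ (M⁻¹ * M⁻¹) *ᵥ v := by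
  obtain ⟨hi, hsym⟩ := if_PD_inv M h
  constructor
  · have e : v ⬝ᵥ M⁻¹ *ᵥ v = (M⁻¹ *ᵥ v) ⬝ᵥ M *ᵥ (M⁻¹ *ᵥ v) := by
      rw [Matrix.mulVec_mulVec, hi, Matrix.one_mulVec, dotProduct_comm]
    rw [e]
    by_cases hy : M⁻¹ *ᵥ v = 0
    · simp [hy]
    · exact (h.2 _ hy).le
  · rw [← Matrix.mulVec_mulVec, Matrix.dotProduct_mulVec, ← Matrix.mulVec_transpose, hsym]
    exact Finset.sum_nonneg fun i _ => mul_self_nonneg _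

lemma if_step {κ ι : Type} [Fintype κ] [DecidableEq κ] [Nonempty κ] [Fintype ι] (v : ι → κ → ℝ)
    (hv : ∑ i, vecMulVec (v i) (v i) = 1) (η δ : ℝ) (hη : 0 < η) (hη1 : η < 1) (hδ : 0 < δ)
    (hδη : 1 / δ = 1 - 3 * η) (M0 K0 : Matrix κ κ ℝ) (hM : IfPD M0) (hK : IfPD K0)
    (hMt : trace M0⁻¹ ≤ η) (hKt : trace K0⁻¹ ≤ η) :
    ∃ (i : ι) (t : ℝ), 0 ≤ t ∧
      IfPD (M0 + δ • 1 + (-t) • vecMulVec (v i) (v i)) ∧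
      trace (M0 + δ • 1 + (-t) • vecMulVec (v i) (v i))⁻¹ ≤ η ∧
      IfPD (K0 + (-1 : ℝ) • 1 + t • vecMulVec (v i) (v i)) ∧
      trace (K0 + (-1 : ℝ) • 1 + t • vecMulVec (v i) (v i))⁻¹ ≤ η := by
  obtain ⟨μ, U, hμ, hU1, hU2, hM0⟩ := if_spec M0 hM
  obtain ⟨ν, V, hν, hV1, hV2, hK0⟩ := if_spec K0 hK
  have tM0 : trace M0⁻¹ = ∑ j, 1 / μ j := by
    have := (if_shift μ U hU1 hU2 0 (by simpa using hμ) M0 hM0).2.1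
    simpa using this
  have tK0 : trace K0⁻¹ = ∑ j, 1 / ν j := by
    have := (if_shift ν V hV1 hV2 0 (by simpa using hν) K0 hK0).2.1
    simpa using this
  have hν1 : ∀ j, 1 < ν j := by
    intro j
    have h1 : 1 / ν j ≤ ∑ j, 1 / ν j :=
      Finset.single_le_sum (f := fun j => 1 / ν j)
        (fun i _ => (one_div_pos.mpr (hν i)).le) (Finset.mem_univ j)
    have h2 : 1 / ν j < 1 := by linarith
    rwa [div_lt_one (hν j)] at h2
  obtain ⟨pM, tM, tM2⟩ := if_shift μ U hU1 hU2 δ (fun j => by linarith [hμ j]) M0 hM0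
  obtain ⟨pK, tK, tK2⟩ := if_shift ν V hV1 hV2 (-1) (fun j => by linarith [hν1 j]) K0 hK0
  obtain ⟨hDu, hup⟩ := if_scal_up μ δ hμ hδ
  obtain ⟨hDl, hlow⟩ := if_scal_low ν hν1 (by linarith)
  rw [← tM2, ← tM, ← tM0] at hup
  rw [← tM, ← tM0] at hDu
  rw [← tK2, ← tK, ← tK0] at hlow
  rw [← tK, ← tK0] at hDl
  set M := M0 + δ • (1 : Matrix κ κ ℝ) with hMdef
  set K := K0 + (-1 : ℝ) • (1 : Matrix κ κ ℝ) with hKdef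
  set Du := trace M0⁻¹ - trace M⁻¹ with hDud
  set Dl := trace K⁻¹ - trace K0⁻¹ with hDld
  have hex : ∃ i, (v i ⬝ᵥ (M⁻¹ * M⁻¹) *ᵥ v i) / Du + v i ⬝ᵥ M⁻¹ *ᵥ v i <
      (v i ⬝ᵥ (K⁻¹ * K⁻¹) *ᵥ v i) / Dl - v i ⬝ᵥ K⁻¹ *ᵥ v i := by
    by_contra hcon
    push Not at hcon
    have := Finset.sum_le_sum (s := Finset.univ) fun i _ => hcon i
    rw [Finset.sum_sub_distrib, Finset.sum_add_distrib, ← Finset.sum_div, ← Finset.sum_div,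
      if_sum_trace v hv, if_sum_trace v hv, if_sum_trace v hv, if_sum_trace v hv] at this
    linarith
  obtain ⟨i, hi⟩ := hex
  obtain ⟨ha, hb⟩ := if_inv_nonneg M pM (v i)
  obtain ⟨hc, hd⟩ := if_inv_nonneg K pK (v i)
  set a := v i ⬝ᵥ M⁻¹ *ᵥ v i with had
  set b := v i ⬝ᵥ (M⁻¹ * M⁻¹) *ᵥ v i with hbd
  set c := v i ⬝ᵥ K⁻¹ *ᵥ v i with hcd
  set d := v i ⬝ᵥ (K⁻¹ * K⁻¹) *ᵥ v i with hdd
  obtain ⟨L, hL⟩ : ∃ L, L = d / Dl - c := ⟨_, rfl⟩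
  rw [← hL] at hi
  have hbD : 0 ≤ b / Du := div_nonneg hb hDu.le
  have hLa : 0 < L - a := by linarith
  have hL0 : 0 < L := by linarith
  have hu1 : 0 < 1 + (-(1 / L)) * a := by
    have : 1 + (-(1 / L)) * a = (L - a) / L := by field_simp; ring
    rw [this]; positivity
  have hl1 : 0 < 1 + (1 / L) * c := by positivity
  obtain ⟨r1, r2⟩ := if_rank_one M pM (v i) (-(1 / L)) hu1
  obtain ⟨r3, r4⟩ := if_rank_one K pK (v i) (1 / L) hl1
  refine ⟨i, 1 / L, by positivity, r1, ?_, r3, ?_⟩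
  · rw [r2, ← had, ← hbd]
    have e : -(1 / L) / (1 + (-(1 / L)) * a) * b = - (b / (L - a)) := by
      have : 1 + (-(1 / L)) * a = (L - a) / L := by field_simp; ring
      rw [this]
      have := hLa.ne'
      field_simp
    rw [e]
    have : b / (L - a) ≤ Du := by
      rw [div_le_iff₀ hLa]
      have : b / Du ≤ L - a := by linarith
      rw [div_le_iff₀ hDu] at this
      linarith
    linarith
  · rw [r4, ← hcd, ← hdd]
    have hLc : 0 < L + c := by linarith
    have e : 1 / L / (1 + 1 / L * c) * d = Dl := by
      have h1 : 1 + 1 / L * c = (L + c) / L := by field_simp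
      have h2 : d = (L + c) * Dl := by
        have : L + c = d / Dl := by linarith
        rw [this]; field_simp
      rw [h1, h2]
      field_simp
    rw [e]
    linarith

lemma if_PD_smul_one {κ : Type} [Fintype κ] [DecidableEq κ] (a : ℝ) (ha : 0 < a) :
    IfPD (a • (1 : Matrix κ κ ℝ)) ∧ trace (a • (1 : Matrix κ κ ℝ))⁻¹ = Fintype.card κ / a := by
  have := if_shift (κ := κ) (fun _ => 0) 1 (by simp) (by simp) a (fun _ => by simpa using ha) 0 (by simp)
  simp only [zero_add] at this
  refine ⟨this.1, ?_⟩
  rw [this.2.1]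
  simp [div_eq_mul_inv]

lemma if_iter {κ ι : Type} [Fintype κ] [DecidableEq κ] [Nonempty κ] [Fintype ι] [DecidableEq ι]
    (v : ι → κ → ℝ)
    (hv : ∑ i, vecMulVec (v i) (v i) = 1) (η δ m : ℝ) (hη : 0 < η) (hη1 : η < 1) (hδ : 0 < δ)
    (hδη : 1 / δ = 1 - 3 * η) (hm : (Fintype.card κ : ℝ) ≤ m) (N : ℕ) :
    ∃ s : ι → ℝ, (∀ i, 0 ≤ s i) ∧ (univ.filter (fun i => s i ≠ 0)).card ≤ N ∧
      IfPD ((m / η + N * δ) • 1 - ∑ i, s i • vecMulVec (v i) (v i)) ∧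
      trace ((m / η + N * δ) • 1 - ∑ i, s i • vecMulVec (v i) (v i))⁻¹ ≤ η ∧
      IfPD ((m / η - N) • 1 + ∑ i, s i • vecMulVec (v i) (v i)) ∧
      trace ((m / η - N) • 1 + ∑ i, s i • vecMulVec (v i) (v i))⁻¹ ≤ η := by
  induction N with
  | zero =>
    have hc : (0 : ℝ) < Fintype.card κ := by exact_mod_cast Fintype.card_pos
    have hm0 : 0 < m := by linarith
    obtain ⟨h1, h2⟩ := if_PD_smul_one (κ := κ) (m / η) (by positivity)
    have h3 : trace ((m / η) • (1 : Matrix κ κ ℝ))⁻¹ ≤ η := by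
      rw [h2, div_le_iff₀ (by positivity)]
      have : η * (m / η) = m := by field_simp
      linarith
    refine ⟨fun _ => 0, by simp, by simp, ?_, ?_, ?_, ?_⟩ <;> simpa
  | succ N ih =>
    obtain ⟨s, hs, hcard, p1, p2, p3, p4⟩ := ih
    obtain ⟨i, t, ht, q1, q2, q3, q4⟩ := if_step v hv η δ hη hη1 hδ hδη _ _ p1 p3 p2 p4
    have hsum : ∑ k, (s + Pi.single i t : ι → ℝ) k • vecMulVec (v k) (v k)
        = ∑ k, s k • vecMulVec (v k) (v k) + t • vecMulVec (v i) (v i) := by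
      simp only [Pi.add_apply, add_smul, Finset.sum_add_distrib]
      congr 1
      rw [Finset.sum_eq_single i]
      · simp
      · intro b _ hb; simp [hb]
      · simp
    have eM : (m / η + (N + 1 : ℕ) * δ) • (1 : Matrix κ κ ℝ)
          - ∑ k, (s + Pi.single i t : ι → ℝ) k • vecMulVec (v k) (v k)
        = (m / η + N * δ) • 1 - ∑ i, s i • vecMulVec (v i) (v i) + δ • 1
          + (-t) • vecMulVec (v i) (v i) := by
      rw [hsum]; push_cast; module
    have eK : (m / η - (N + 1 : ℕ)) • (1 : Matrix κ κ ℝ)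
          + ∑ k, (s + Pi.single i t : ι → ℝ) k • vecMulVec (v k) (v k)
        = (m / η - N) • 1 + ∑ i, s i • vecMulVec (v i) (v i) + (-1 : ℝ) • 1
          + t • vecMulVec (v i) (v i) := by
      rw [hsum]; push_cast; module
    refine ⟨s + Pi.single i t, ?_, ?_, ?_, ?_, ?_, ?_⟩
    · intro k
      have : (0 : ℝ) ≤ (Pi.single i t : ι → ℝ) k := by
        by_cases h : k = i
        · subst h; simpa
        · simp [h]
      exact add_nonneg (hs k) this
    · have hsub : univ.filter (fun k => (s + Pi.single i t : ι → ℝ) k ≠ 0) ⊆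
          insert i (univ.filter (fun i => s i ≠ 0)) := by
        intro k hk
        simp only [Finset.mem_filter, Finset.mem_univ, true_and, Finset.mem_insert] at hk ⊢
        by_cases h : k = i
        · exact Or.inl h
        · right; simpa [h] using hk
      exact (Finset.card_le_card hsub).trans ((Finset.card_insert_le _ _).trans (by omega))
    · rw [eM]; exact q1
    · rw [eM]; exact q2
    · rw [eK]; exact q3
    · rw [eK]; exact q4

lemma if_quad_sum {κ ι : Type} [Fintype κ] [Fintype ι] (v : ι → κ → ℝ) (s : ι → ℝ) (x : κ → ℝ) :
    x ⬝ᵥ (∑ i, s i • vecMulVec (v i) (v i)) *ᵥ x = ∑ i, s i * (v i ⬝ᵥ x) ^ 2 := by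
  rw [Matrix.sum_mulVec, dotProduct_sum]
  refine Finset.sum_congr rfl fun i _ => ?_
  rw [Matrix.smul_mulVec, if_vv_mulVec, dotProduct_smul, dotProduct_smul, dotProduct_comm x]
  simp only [smul_eq_mul]
  ring

lemma if_bss {κ ι : Type} [Fintype κ] [DecidableEq κ] [Fintype ι] [DecidableEq ι]
    (v : ι → κ → ℝ)
    (hv : ∑ i, vecMulVec (v i) (v i) = 1) (ε m : ℝ) (hε : 0 < ε) (hε1 : ε < 1)
    (hm : (Fintype.card κ : ℝ) ≤ m) :
    ∃ s : ι → ℝ, (∀ i, 0 ≤ s i) ∧ (univ.filter (fun i => s i ≠ 0)).card ≤ ⌈49 * m / ε ^ 2⌉₊ ∧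
      ∀ x : κ → ℝ, (1 - ε) * (x ⬝ᵥ x) ≤ ∑ i, s i * (v i ⬝ᵥ x) ^ 2 ∧
        ∑ i, s i * (v i ⬝ᵥ x) ^ 2 ≤ (1 + ε) * (x ⬝ᵥ x) := by
  rcases isEmpty_or_nonempty κ with hκ | hκ
  · refine ⟨fun _ => 0, by simp, by simp, fun x => ?_⟩
    simp [dotProduct]
  obtain ⟨η, hηe⟩ : ∃ η, η = ε / 7 := ⟨_, rfl⟩
  have hη : 0 < η := by rw [hηe]; positivity
  have hη7 : η < 1 / 7 := by rw [hηe]; linarith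
  have h3 : 0 < 1 - 3 * η := by linarith
  have hc : (0 : ℝ) < Fintype.card κ := by exact_mod_cast Fintype.card_pos
  have hm0 : 0 < m := by linarith
  set N := ⌈49 * m / ε ^ 2⌉₊ with hN
  have hNle : 49 * m / ε ^ 2 ≤ N := Nat.le_ceil _
  have hN0 : (0 : ℝ) < N := lt_of_lt_of_le (by positivity) hNle
  have hmN : m / η ≤ η * N := by
    have : 49 * m / ε ^ 2 = m / η / η := by rw [hηe]; field_simp; norm_num
    rw [this, div_le_iff₀ hη] at hNle
    linarith
  have hδ : 1 / (1 - 3 * η) ≤ 1 + 6 * η := by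
    rw [div_le_iff₀ h3]
    nlinarith
  obtain ⟨s, hs, hcard, p1, -, p3, -⟩ := if_iter v hv η (1 / (1 - 3 * η)) m hη (by linarith)
    (by positivity) (by rw [one_div_one_div]) hm N
  refine ⟨fun i => s i / N, fun i => div_nonneg (hs i) hN0.le, ?_, fun x => ?_⟩
  · refine le_trans (Finset.card_le_card ?_) hcard
    intro k hk
    simp only [Finset.mem_filter, Finset.mem_univ, true_and] at hk ⊢
    intro h; apply hk; simp [h]
  have hsum : ∑ i, s i / N * (v i ⬝ᵥ x) ^ 2 = (∑ i, s i * (v i ⬝ᵥ x) ^ 2) / N := by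
    rw [Finset.sum_div]
    exact Finset.sum_congr rfl fun i _ => by ring
  rw [hsum]
  by_cases hx : x = 0
  · simp [hx]
  have g1 := p1.2 x hx
  have g2 := p3.2 x hx
  rw [Matrix.sub_mulVec, dotProduct_sub, if_quad_sum, Matrix.smul_mulVec, Matrix.one_mulVec,
    dotProduct_smul, smul_eq_mul] at g1
  rw [Matrix.add_mulVec, dotProduct_add, if_quad_sum, Matrix.smul_mulVec, Matrix.one_mulVec,
    dotProduct_smul, smul_eq_mul] at g2
  have hxx : 0 ≤ x ⬝ᵥ x := Finset.sum_nonneg fun i _ => mul_self_nonneg _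
  have he : ε = 7 * η := by rw [hηe]; ring
  constructor
  · rw [le_div_iff₀ hN0]
    have : (1 - ε) * N ≤ N - m / η := by nlinarith
    nlinarith [mul_le_mul_of_nonneg_right this hxx]
  · rw [div_le_iff₀ hN0]
    have : m / η + N * (1 / (1 - 3 * η)) ≤ (1 + ε) * N := by nlinarith
    nlinarith [mul_le_mul_of_nonneg_right this hxx]

lemma if_gen {n : ℕ} {ι : Type} [Fintype ι] [DecidableEq ι]
    (v : ι → Fin n → ℝ) (ε : ℝ) (hε : 0 < ε) (hε1 : ε < 1) :
    ∃ s : ι → ℝ, (∀ i, 0 ≤ s i) ∧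
      (univ.filter (fun i => s i ≠ 0)).card ≤ ⌈49 * (n : ℝ) / ε ^ 2⌉₊ ∧
      ∀ x : Fin n → ℝ, (1 - ε) * ∑ i, (v i ⬝ᵥ x) ^ 2 ≤ ∑ i, s i * (v i ⬝ᵥ x) ^ 2 ∧
        ∑ i, s i * (v i ⬝ᵥ x) ^ 2 ≤ (1 + ε) * ∑ i, (v i ⬝ᵥ x) ^ 2 := by
  classical
  obtain ⟨B, hB⟩ : ∃ B, B = ∑ i, vecMulVec (v i) (v i) := ⟨_, rfl⟩
  obtain ⟨μ, U, hU1, hU2, hBU⟩ := if_spec_sym B (by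
    rw [hB, Matrix.transpose_sum]; simp [Matrix.transpose_vecMulVec])
  have hquad : ∀ x, ∑ i, (v i ⬝ᵥ x) ^ 2 = ∑ j, μ j * ((Uᵀ *ᵥ x) j) ^ 2 := by
    intro x
    rw [← if_quad_diag, ← hBU, hB]
    have := if_quad_sum v (fun _ => 1) x
    simpa using this.symm
  obtain ⟨c, hc⟩ : ∃ c : ι → Fin n → ℝ, c = fun i => Uᵀ *ᵥ v i := ⟨_, rfl⟩
  have hcc : ∑ i, vecMulVec (c i) (c i) = diagonal μ := by
    have e : Uᵀ * B * U = diagonal μ := by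
      rw [hBU]
      calc _ = (Uᵀ * U) * diagonal μ * (Uᵀ * U) := by simp only [Matrix.mul_assoc]
        _ = _ := by rw [hU2]; simp
    rw [← e, hB, Matrix.mul_sum, Matrix.sum_mul, hc]
    refine Finset.sum_congr rfl fun i _ => ?_
    rw [Matrix.mul_vecMulVec, Matrix.vecMulVec_mul, ← Matrix.mulVec_transpose]
  have hent : ∀ a b, ∑ i, c i a * c i b = if a = b then μ a else 0 := by
    intro a b
    have := congrFun (congrFun hcc a) b
    rw [Matrix.sum_apply, Matrix.diagonal_apply] at this
    simpa [vecMulVec_apply] using this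
  have hμ0 : ∀ a, 0 ≤ μ a := by
    intro a
    have := hent a a
    rw [if_pos rfl] at this
    rw [← this]
    exact Finset.sum_nonneg fun i _ => mul_self_nonneg _
  have hcz : ∀ a, μ a = 0 → ∀ i, c i a = 0 := by
    intro a ha i
    have := hent a a
    rw [if_pos rfl, ha, Finset.sum_eq_zero_iff_of_nonneg (fun i _ => mul_self_nonneg _)] at this
    exact mul_self_eq_zero.mp (this i (Finset.mem_univ _))
  let κ := {a : Fin n // μ a ≠ 0}
  have hpos : ∀ a : κ, 0 < Real.sqrt (μ a) := fun a =>
    Real.sqrt_pos.mpr (lt_of_le_of_ne (hμ0 _) (Ne.symm a.2))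
  obtain ⟨z, hz⟩ : ∃ z : ι → κ → ℝ, z = fun i (a : κ) => c i a / Real.sqrt (μ a) := ⟨_, rfl⟩
  have hzz : ∑ i, vecMulVec (z i) (z i) = 1 := by
    ext a b
    rw [Matrix.sum_apply, Matrix.one_apply]
    simp only [vecMulVec_apply, hz]
    have e : ∑ i, c i a / Real.sqrt (μ a) * (c i b / Real.sqrt (μ b))
        = (∑ i, c i a * c i b) / (Real.sqrt (μ a) * Real.sqrt (μ b)) := by
      rw [Finset.sum_div]
      exact Finset.sum_congr rfl fun i _ => by rw [div_mul_div_comm]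
    rw [e, hent]
    by_cases hab : a = b
    · subst hab
      rw [if_pos rfl, if_pos rfl, Real.mul_self_sqrt (hμ0 _), div_self a.2]
    · have : (a : Fin n) ≠ b := fun h => hab (Subtype.ext h)
      rw [if_neg hab, if_neg this, zero_div]
  have hcard : (Fintype.card κ : ℝ) ≤ n := by
    have := Fintype.card_subtype_le (fun a : Fin n => μ a ≠ 0)
    rw [Fintype.card_fin] at this
    exact_mod_cast this
  obtain ⟨s, hs, hsc, hsx⟩ := if_bss z hzz ε n hε hε1 hcard
  refine ⟨s, hs, hsc, fun x => ?_⟩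
  have hsub : ∀ f : Fin n → ℝ, (∀ a, μ a = 0 → f a = 0) → ∑ a : κ, f a = ∑ a, f a := by
    intro f hf
    have h1 : ∑ a ∈ univ.filter (fun a => μ a ≠ 0), f a = ∑ a : κ, f a :=
      Finset.sum_subtype _ (by simp) f
    rw [← h1]
    apply Finset.sum_subset (Finset.subset_univ _)
    intro a _ ha
    apply hf
    simpa using ha
  have hy := hsx (fun a => Real.sqrt (μ a) * (Uᵀ *ᵥ x) a)
  have e1 : (fun a : κ => Real.sqrt (μ a) * (Uᵀ *ᵥ x) a) ⬝ᵥ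
      (fun a : κ => Real.sqrt (μ a) * (Uᵀ *ᵥ x) a) = ∑ i, (v i ⬝ᵥ x) ^ 2 := by
    rw [hquad, ← hsub _ (fun a ha => by rw [ha, zero_mul])]
    unfold dotProduct
    refine Finset.sum_congr rfl fun a _ => ?_
    have := Real.mul_self_sqrt (hμ0 a)
    linear_combination ((Uᵀ *ᵥ x) a) ^ 2 * this
  have e2 : ∀ i, z i ⬝ᵥ (fun a : κ => Real.sqrt (μ a) * (Uᵀ *ᵥ x) a) = v i ⬝ᵥ x := by
    intro i
    have h1 : v i ⬝ᵥ x = ∑ a, c i a * (Uᵀ *ᵥ x) a := by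
      have : c i ⬝ᵥ (Uᵀ *ᵥ x) = v i ⬝ᵥ x := by
        rw [hc, Matrix.dotProduct_mulVec, ← Matrix.mulVec_transpose, Matrix.transpose_transpose,
          Matrix.mulVec_mulVec, hU1, Matrix.one_mulVec]
      rw [← this]; rfl
    rw [h1, ← hsub _ (fun a ha => by rw [hcz a ha, zero_mul])]
    unfold dotProduct
    refine Finset.sum_congr rfl fun a _ => ?_
    have := (hpos a).ne'
    rw [hz]
    field_simp
  rw [e1] at hy
  simp only [e2] at hy
  exact hy

lemma if_lap {n : ℕ} (w : Fin n → Fin n → ℝ) (hw : ∀ i j, w i j = w j i) (x : Fin n → ℝ) :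
    x ⬝ᵥ (combLaplacian w).mulVec x
      = ∑ p : Fin n × Fin n, if p.1 < p.2 then w p.1 p.2 * (x p.1 - x p.2) ^ 2 else 0 := by
  have h1 : x ⬝ᵥ (combLaplacian w).mulVec x = ∑ i, ∑ j, w i j * (x i * x i - x i * x j) := by
    unfold combLaplacian
    rw [Matrix.sub_mulVec, dotProduct_sub]
    simp only [dotProduct, Matrix.mulVec_diagonal]
    rw [← Finset.sum_sub_distrib]
    refine Finset.sum_congr rfl fun i _ => ?_
    simp only [Matrix.mulVec, dotProduct, Matrix.of_apply]
    rw [Finset.sum_mul, Finset.mul_sum, Finset.mul_sum, ← Finset.sum_sub_distrib]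
    exact Finset.sum_congr rfl fun j _ => by ring
  have h2 : ∑ i, ∑ j, w i j * (x i * x i - x i * x j)
      = ∑ i, ∑ j, w i j * (x j * x j - x i * x j) := by
    rw [Finset.sum_comm]
    refine Finset.sum_congr rfl fun i _ => Finset.sum_congr rfl fun j _ => ?_
    rw [hw j i]; ring
  have h3 : ∑ i, ∑ j, (if i < j then w i j * (x i - x j) ^ 2 else 0)
      = ∑ i, ∑ j, (if j < i then w i j * (x i - x j) ^ 2 else 0) := by
    rw [Finset.sum_comm]
    refine Finset.sum_congr rfl fun i _ => Finset.sum_congr rfl fun j _ => ?_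
    rw [hw j i]
    split_ifs <;> ring
  have h4 : ∑ i, ∑ j, w i j * (x i * x i - x i * x j) + ∑ i, ∑ j, w i j * (x j * x j - x i * x j)
      = ∑ i, ∑ j, (if i < j then w i j * (x i - x j) ^ 2 else 0)
        + ∑ i, ∑ j, (if j < i then w i j * (x i - x j) ^ 2 else 0) := by
    simp only [← Finset.sum_add_distrib]
    refine Finset.sum_congr rfl fun i _ => Finset.sum_congr rfl fun j _ => ?_
    rcases lt_trichotomy i j with h | h | h
    · rw [if_pos h, if_neg h.not_gt]; ring
    · subst h; simp
    · rw [if_neg h.not_gt, if_pos h]; ring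
  rw [h1, Fintype.sum_prod_type]
  linarith

theorem interface_sparsification :
    ∃ c : ℝ, 0 < c ∧
      ∀ (n : ℕ) (w : Fin n → Fin n → ℝ) (side : Fin n → Bool),
        (∀ i j, w i j = w j i) →
        (∀ i j, 0 ≤ w i j) →
        (∀ i, w i i = 0) →
        ∀ ε : ℝ, ε ∈ Set.Ioo (0 : ℝ) 1 →
        ∃ w' : Fin n → Fin n → ℝ,
          (∀ i j, w' i j = w' j i) ∧
          (∀ i j, 0 ≤ w' i j) ∧
          (∀ i j, w' i j ≠ 0 → side i ≠ side j ∧ w i j ≠ 0) ∧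
          (univ.filter
              (fun p : Fin n × Fin n => p.1 < p.2 ∧ w' p.1 p.2 ≠ 0)).card
            ≤ ⌈c * n * Real.log n / ε ^ 2⌉₊ ∧
          ∀ x : Fin n → ℝ,
            (1 - ε) * (x ⬝ᵥ (combLaplacian w).mulVec x)
              ≤ x ⬝ᵥ (combLaplacian (fun i j =>
                  (if side i = side j then w i j else 0) + w' i j)).mulVec x ∧
            x ⬝ᵥ (combLaplacian (fun i j =>
                  (if side i = side j then w i j else 0) + w' i j)).mulVec x
              ≤ (1 + ε) * (x ⬝ᵥ (combLaplacian w).mulVec x) := by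
  refine ⟨100, by norm_num, ?_⟩
  intro n w side hsym hnn _ ε hε
  obtain ⟨hε0, hε1⟩ := hε
  obtain ⟨s, hs, hsc, hsx⟩ := if_gen (fun (p : Fin n × Fin n) (k : Fin n) =>
    if p.1 < p.2 ∧ side p.1 ≠ side p.2 then
      Real.sqrt (w p.1 p.2) * ((if k = p.1 then 1 else 0) - (if k = p.2 then 1 else 0)) else 0)
    ε hε0 hε1
  obtain ⟨w', hw'⟩ : ∃ w' : Fin n → Fin n → ℝ, w' = fun i j =>
      if side i = side j then 0 else (if i < j then s (i, j) else s (j, i)) * w i j := ⟨_, rfl⟩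
  have hw's : ∀ i j, w' i j = w' j i := by
    intro i j
    rw [hw']
    dsimp only
    by_cases h : side i = side j
    · rw [if_pos h, if_pos h.symm]
    · rw [if_neg h, if_neg (Ne.symm h : ¬ side j = side i), hsym j i]
      rcases lt_trichotomy i j with g | g | g
      · rw [if_pos g, if_neg g.not_gt]
      · exact absurd (by rw [g]) h
      · rw [if_pos g, if_neg g.not_gt]
  refine ⟨w', hw's, ?_, ?_, ?_, ?_⟩
  · intro i j
    rw [hw']
    dsimp only
    split_ifs
    · exact le_rfl
    · exact mul_nonneg (hs _) (hnn _ _)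
    · exact mul_nonneg (hs _) (hnn _ _)
  · intro i j h
    rw [hw'] at h
    dsimp only at h
    by_cases g : side i = side j
    · rw [if_pos g] at h; exact absurd rfl h
    · rw [if_neg g] at h
      exact ⟨g, right_ne_zero_of_mul h⟩
  · rcases Nat.lt_or_ge n 2 with hn | hn
    · have : univ.filter (fun p : Fin n × Fin n => p.1 < p.2 ∧ w' p.1 p.2 ≠ 0) = ∅ := by
        apply Finset.filter_eq_empty_iff.mpr
        rintro ⟨a, b⟩ _ ⟨h, _⟩
        have : (a : ℕ) < b := h
        have := b.2
        omega
      rw [this]; simp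
    · refine le_trans (le_trans (Finset.card_le_card ?_) hsc) ?_
      · intro p hp
        simp only [Finset.mem_filter, Finset.mem_univ, true_and] at hp ⊢
        obtain ⟨h1, h2⟩ := hp
        rw [hw'] at h2
        dsimp only at h2
        rw [if_pos h1] at h2
        intro h0
        apply h2
        rw [h0]; simp
      · apply Nat.ceil_le_ceil
        have hlog : Real.log 2 ≤ Real.log n :=
          Real.log_le_log (by norm_num) (by exact_mod_cast hn)
        have := Real.log_two_gt_d9
        have hn0 : (0 : ℝ) ≤ n := Nat.cast_nonneg n
        apply div_le_div_of_nonneg_right _ (by positivity)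
        have hl : (0.6 : ℝ) ≤ Real.log n := by linarith
        nlinarith [mul_le_mul_of_nonneg_left hl hn0]
  · intro x
    have hx := hsx x
    have hdot : ∀ p : Fin n × Fin n, ((fun k : Fin n =>
        if p.1 < p.2 ∧ side p.1 ≠ side p.2 then
          Real.sqrt (w p.1 p.2) * ((if k = p.1 then 1 else 0) - (if k = p.2 then 1 else 0)) else 0)
          ⬝ᵥ x) ^ 2 = if p.1 < p.2 then
            (if side p.1 = side p.2 then 0 else w p.1 p.2) * (x p.1 - x p.2) ^ 2 else 0 := by
      intro p
      by_cases h1 : p.1 < p.2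
      · by_cases h2 : side p.1 = side p.2
        · simp [h1, h2, dotProduct]
        · have hd : (fun k : Fin n =>
              if p.1 < p.2 ∧ side p.1 ≠ side p.2 then
                Real.sqrt (w p.1 p.2) * ((if k = p.1 then 1 else 0) - (if k = p.2 then 1 else 0))
                else 0) ⬝ᵥ x = Real.sqrt (w p.1 p.2) * (x p.1 - x p.2) := by
            simp only [h1, h2, dotProduct, ne_eq, not_false_eq_true, and_self, if_true]
            simp only [mul_assoc, ← Finset.mul_sum, sub_mul, Finset.sum_sub_distrib]
            simp
          rw [hd, mul_pow, Real.sq_sqrt (hnn _ _), if_pos h1, if_neg h2]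
      · simp [h1, dotProduct]
    simp only [hdot] at hx
    rw [if_lap w hsym, if_lap _ (fun i j => by
      rw [hw's i j, hsym i j]; simp only [eq_comm])]
    obtain ⟨I, hI⟩ : ∃ I, I = ∑ p : Fin n × Fin n, if p.1 < p.2 then
      (if side p.1 = side p.2 then w p.1 p.2 else 0) * (x p.1 - x p.2) ^ 2 else 0 := ⟨_, rfl⟩
    have hI0 : 0 ≤ I := by
      rw [hI]
      apply Finset.sum_nonneg
      intro p _
      split_ifs
      · exact mul_nonneg (hnn _ _) (sq_nonneg _)
      · simp
      · exact le_rfl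
    have e1 : (∑ p : Fin n × Fin n, if p.1 < p.2 then w p.1 p.2 * (x p.1 - x p.2) ^ 2 else 0)
        = I + ∑ p : Fin n × Fin n, if p.1 < p.2 then
            (if side p.1 = side p.2 then 0 else w p.1 p.2) * (x p.1 - x p.2) ^ 2 else 0 := by
      rw [hI, ← Finset.sum_add_distrib]
      refine Finset.sum_congr rfl fun p _ => ?_
      split_ifs <;> ring
    have e2 : (∑ p : Fin n × Fin n, if p.1 < p.2 then
          ((if side p.1 = side p.2 then w p.1 p.2 else 0) + w' p.1 p.2) * (x p.1 - x p.2) ^ 2 else 0)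
        = I + ∑ p : Fin n × Fin n, s p * if p.1 < p.2 then
            (if side p.1 = side p.2 then 0 else w p.1 p.2) * (x p.1 - x p.2) ^ 2 else 0 := by
      rw [hI, ← Finset.sum_add_distrib]
      refine Finset.sum_congr rfl fun p _ => ?_
      rw [hw']
      dsimp only
      split_ifs <;> ring
    rw [e1, e2]
    constructor
    · nlinarith [hx.1, mul_nonneg hε0.le hI0]
    · nlinarith [hx.2, mul_nonneg hε0.le hI0]
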